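/- arXiv:2106.15300 — 9 statements merged into one kernel-verified Lean document; each statement's English description precedes it below -/
import Mathlib

section
/- Let q ≥ 3 be an odd integer and k an integer with gcd(k,q) = 1. Then cos(2πk((q−1)/2 + 1)/q) = cos(2πk(q−1)/(2q)·(2π-free form: cos(πk(q+1)/q) = cos(πk(q−1)/q)), and consequently the sum ∑_{l=0}^{q−1} l · 2cos(2πk(l − (q−1)/2)/q) = 0. Hence convolution with the circular shift by (q−1)/2 of one period of the CCPS annihilates ramp inputs (second-derivative property). -/
/-- The Dirichlet-kernel sum of equally spaced cosines, by telescoping. -/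
theorem two_mul_sin_mul_sum_cos (θ a : ℝ) (n : ℕ) :
    2 * Real.sin (θ / 2) * ∑ l ∈ Finset.range n, Real.cos (θ * (l - a)) =
      Real.sin (θ * (n - a - 1 / 2)) - Real.sin (θ * (-a - 1 / 2)) := by
  induction n with
  | zero => simp
  | succ n ih =>
    rw [Finset.sum_range_succ, mul_add, ih, Real.two_mul_sin_mul_cos]
    have h₁ : θ / 2 - θ * (n - a) = -(θ * (n - a - 1 / 2)) := by ring
    have h₂ : θ / 2 + θ * (n - a) = θ * ((n + 1 : ℕ) - a - 1 / 2) := by push_cast; ring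
    rw [h₁, h₂, Real.sin_neg]
    ring

theorem sin_pi_mul_int_div_ne_zero {q : ℕ} {k : ℤ} (hq : q ≠ 0) (hk : ¬ (q : ℤ) ∣ k) :
    Real.sin (Real.pi * k / q) ≠ 0 := by
  rw [Real.sin_ne_zero_iff]
  intro n hn
  have hq' : (q : ℝ) ≠ 0 := Nat.cast_ne_zero.mpr hq
  rw [eq_div_iff hq'] at hn
  have h : (k : ℝ) = q * n := mul_left_cancel₀ Real.pi_ne_zero (by linarith)
  exact hk ⟨n, by exact_mod_cast h⟩

/-- The half-shifted period of cosines of a frequency `k` not divisible by `q` has zero sum. -/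
theorem sum_cos_half_shift_eq_zero {q : ℕ} {k : ℤ} (hq : q ≠ 0) (hk : ¬ (q : ℤ) ∣ k) :
    ∑ l ∈ Finset.range q,
      Real.cos (2 * Real.pi * k * ((l : ℝ) - ((q : ℝ) - 1) / 2) / q) = 0 := by
  have hq' : (q : ℝ) ≠ 0 := Nat.cast_ne_zero.mpr hq
  have h := two_mul_sin_mul_sum_cos (2 * Real.pi * k / q) (((q : ℝ) - 1) / 2) q
  have h₀ : 2 * Real.pi * k / q / 2 = Real.pi * k / q := by ring
  have h₁ : 2 * Real.pi * k / q * (q - ((q : ℝ) - 1) / 2 - 1 / 2) = k * Real.pi := by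
    field_simp
    ring
  have h₂ : 2 * Real.pi * k / q * (-(((q : ℝ) - 1) / 2) - 1 / 2) = -(k * Real.pi) := by
    field_simp
    ring
  rw [h₀, h₁, h₂, Real.sin_neg, Real.sin_int_mul_pi, neg_zero, sub_zero] at h
  simp_rw [mul_div_right_comm (2 * Real.pi * k)]
  exact (mul_eq_zero.mp h).resolve_left
    (mul_ne_zero two_ne_zero (sin_pi_mul_int_div_ne_zero hq hk))

/-- A sequence on `0, …, q - 1` that is symmetric about its centre and has zero sum
annihilates ramps. -/
theorem sum_range_mul_eq_zero_of_symm {q : ℕ} {f : ℕ → ℝ}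
    (hsymm : ∀ l < q, f (q - 1 - l) = f l) (hsum : ∑ l ∈ Finset.range q, f l = 0) :
    ∑ l ∈ Finset.range q, (l : ℝ) * f l = 0 := by
  have h : ∑ l ∈ Finset.range q, (l : ℝ) * f l =
      ∑ l ∈ Finset.range q, (((q : ℝ) - 1) * f l - l * f l) := by
    rw [← Finset.sum_range_reflect]
    refine Finset.sum_congr rfl fun l hl => ?_
    have hl := Finset.mem_range.mp hl
    rw [hsymm l hl, Nat.sub_sub, Nat.cast_sub (by omega)]
    push_cast
    ring
  rw [Finset.sum_sub_distrib, ← Finset.mul_sum, hsum] at h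
  linarith

/-- For odd `q ≥ 3` and `gcd(k,q) = 1`, one has
`cos(πk(q+1)/q) = cos(πk(q−1)/q)`, and consequently the circular shift by
`(q−1)/2` of one period of the CCPS annihilates ramp inputs:
`∑_{l=0}^{q−1} l · 2cos(2πk(l − (q−1)/2)/q) = 0`. -/
theorem ccps_half_shift_annihilates_ramp (q : ℕ) (k : ℤ) (hq : 3 ≤ q) (hodd : Odd q)
    (hgcd : Int.gcd k q = 1) :
    (Real.cos (Real.pi * k * ((q : ℝ) + 1) / q) = Real.cos (Real.pi * k * ((q : ℝ) - 1) / q)) ∧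
    ∑ l ∈ Finset.range q,
      (l : ℝ) * (2 * Real.cos (2 * Real.pi * k * ((l : ℝ) - ((q : ℝ) - 1) / 2) / q)) = 0 := by
  have hq₀ : q ≠ 0 := by omega
  have hq' : (q : ℝ) ≠ 0 := Nat.cast_ne_zero.mpr hq₀
  have hk : ¬ (q : ℤ) ∣ k := fun h => by
    have h' := Int.dvd_coe_gcd h dvd_rfl
    rw [hgcd, Int.natCast_dvd_natCast, Nat.dvd_one] at h'
    omega
  constructor
  · have h : Real.pi * k * ((q : ℝ) + 1) / q =
        k * (2 * Real.pi) - Real.pi * k * ((q : ℝ) - 1) / q := by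
      field_simp
      ring
    rw [h, Real.cos_int_mul_two_pi_sub]
  · refine sum_range_mul_eq_zero_of_symm (fun l hl => ?_) ?_
    · rw [Nat.sub_sub, Nat.cast_sub (by omega), ← Real.cos_neg]
      push_cast
      ring_nf
    · rw [← Finset.mul_sum, sum_cos_half_shift_eq_zero hq₀ hk, mul_zero]
end

section
/- Let q ≥ 3 be an integer and k an integer with 1 ≤ k ≤ ⌊q/2⌋ and gcd(k,q) = 1. The column space of the q×q circulant matrix D_{q,k}, whose (i,j) entry is 2cos(2πk(i−j)/q), equals the complex conjugate subspace v_{q,k}, i.e. the ℂ-span in ℂ^q of the circular shifts of one period of the CCPS equals the ℂ-span of the two vectors (e^{2πikn/q})_{n=0}^{q−1} and (e^{−2πikn/q})_{n=0}^{q−1}. -/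
/-- If `z ^ 2 ≠ 1`, the combinations `z⁻¹ ^ j • u + z ^ j • v` for `j < q` span the same
subspace as `u` and `v`, as soon as `2 ≤ q`. -/
lemma span_range_inv_pow_smul_add_pow_smul {K M : Type*} [Field K] [AddCommGroup M] [Module K M]
    {q : ℕ} (hq : 2 ≤ q) {z : K} (hz : z ≠ 0) (hz2 : z ^ 2 ≠ 1) (u v : M) :
    Submodule.span K (Set.range fun j : Fin q => z⁻¹ ^ (j : ℕ) • u + z ^ (j : ℕ) • v) =
      Submodule.span K {u, v} := by
  apply le_antisymm
  · rw [Submodule.span_le]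
    rintro _ ⟨j, rfl⟩
    exact Submodule.mem_span_pair.mpr ⟨_, _, rfl⟩
  · set S := Submodule.span K (Set.range fun j : Fin q => z⁻¹ ^ (j : ℕ) • u + z ^ (j : ℕ) • v)
    have hmem (j : Fin q) : z⁻¹ ^ (j : ℕ) • u + z ^ (j : ℕ) • v ∈ S :=
      Submodule.subset_span ⟨j, rfl⟩
    have h0 : u + v ∈ S := by simpa using hmem ⟨0, by omega⟩
    have h1 : z⁻¹ • u + z • v ∈ S := by simpa using hmem ⟨1, by omega⟩
    have hne : z - z⁻¹ ≠ 0 := fun h => hz2 (by field_simp at h; linear_combination h)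
    have hv : v ∈ S := by
      rw [← S.smul_mem_iff hne]
      convert S.sub_mem h1 (S.smul_mem z⁻¹ h0) using 1
      module
    have hu : u ∈ S := (S.add_mem_iff_left hv).mp h0
    rw [Submodule.span_le, Set.insert_subset_iff, Set.singleton_subset_iff]
    exact ⟨hu, hv⟩

/-- For `3 ≤ q` and `k` coprime to `q`, the square of `exp (2πik / q)` is not `1`. -/
lemma exp_two_pi_mul_div_sq_ne_one {q k : ℕ} (hq : 3 ≤ q) (hgcd : Nat.gcd k q = 1) :
    Complex.exp (2 * (Real.pi : ℂ) * Complex.I * (k : ℂ) / (q : ℂ)) ^ 2 ≠ 1 := by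
  intro h
  have hprim := Complex.isPrimitiveRoot_exp_of_coprime k q (by omega) hgcd
  rw [← mul_div_assoc] at hprim
  exact absurd (Nat.le_of_dvd two_pos (hprim.dvd_of_pow_eq_one 2 h)) (by omega)

/-- The column space of the circulant matrix `D_{q,k}` (with `(i,j)` entry
`2cos(2πk(i−j)/q)`) equals the complex conjugate subspace `v_{q,k}`, i.e. the
span of the circular shifts of one period of the CCPS equals the span of the
two exponential vectors `e^{±2πikn/q}`. -/
theorem column_space_circulant_eq_ccs (q k : ℕ) (hq : 3 ≤ q)
    (hk1 : 1 ≤ k) (hk2 : k ≤ q / 2) (hgcd : Nat.gcd k q = 1) :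
    Submodule.span ℂ (Set.range (fun j : Fin q => (fun i : Fin q =>
        ((2 * Real.cos (2 * Real.pi * (k : ℝ) * (((i : ℕ) : ℝ) - ((j : ℕ) : ℝ)) / (q : ℝ)) : ℝ) : ℂ)))) =
      Submodule.span ℂ
        {(fun n : Fin q =>
            Complex.exp (2 * (Real.pi : ℂ) * Complex.I * (k : ℂ) * ((n : ℕ) : ℂ) / (q : ℂ))),
         (fun n : Fin q =>
            Complex.exp (-(2 * (Real.pi : ℂ) * Complex.I * (k : ℂ) * ((n : ℕ) : ℂ)) / (q : ℂ)))} := by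
  set z := Complex.exp (2 * (Real.pi : ℂ) * Complex.I * (k : ℂ) / (q : ℂ))
  rw [← span_range_inv_pow_smul_add_pow_smul (by omega : 2 ≤ q) (Complex.exp_ne_zero _ : z ≠ 0)
    (exp_two_pi_mul_div_sq_ne_one hq hgcd)]
  congr 2
  ext j i
  simp only [Pi.add_apply, Pi.smul_apply, smul_eq_mul, ← Complex.exp_neg,
    ← Complex.exp_nat_mul, ← Complex.exp_add]
  push_cast
  rw [Complex.two_cos]
  congr 2 <;> ring
end

section
/- Let q ≥ 3 be an integer, k an integer with 1 ≤ k ≤ ⌊q/2⌋ and gcd(k,q) = 1, and l any integer. Then the two vectors in ℂ^q with entries (2cos(2πk(n−l)/q))_{n=0}^{q−1} and (2cos(2πk(n−l−1)/q))_{n=0}^{q−1} (two consecutive circular shifts of one period of the CCPS) are linearly independent over ℂ and span the complex conjugate subspace v_{q,k}; in particular they form a basis of v_{q,k}. -/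
/-- An invertible `2 × 2` change of coordinates does not change the span of a pair of vectors. -/
theorem span_pair_smul_add_smul {K V : Type*} [Field K] [AddCommGroup V] [Module K V]
    (u v : V) {r s t w : K} (h : r * w - s * t ≠ 0) :
    Submodule.span K {r • u + s • v, t • u + w • v} = Submodule.span K {u, v} := by
  apply le_antisymm <;> rw [Submodule.span_le, Set.pair_subset_iff] <;>
    simp only [SetLike.mem_coe, Submodule.mem_span_pair]
  · exact ⟨⟨r, s, rfl⟩, ⟨t, w, rfl⟩⟩
  · have hinv := mul_inv_cancel₀ h
    refine ⟨⟨w * (r * w - s * t)⁻¹, -s * (r * w - s * t)⁻¹, ?_⟩,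
      ⟨-t * (r * w - s * t)⁻¹, r * (r * w - s * t)⁻¹, ?_⟩⟩ <;>
    match_scalars <;> grind

/-- If `k` is coprime to `q ≥ 3`, then `e^{2πik/q}` differs from its complex conjugate. -/
theorem exp_two_pi_mul_I_div_ne_exp_neg {q k : ℕ} (hq : 3 ≤ q) (hgcd : Nat.gcd k q = 1) :
    Complex.exp (2 * Real.pi * Complex.I * k / q) ≠
      Complex.exp (-(2 * Real.pi * Complex.I * k) / q) := by
  intro h
  obtain ⟨n, hn⟩ := Complex.exp_eq_exp_iff_exists_int.1 h
  have hq0 : (q : ℂ) ≠ 0 := by norm_cast; lia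
  have hkn : (2 * k : ℂ) = q * n := by
    apply mul_left_cancel₀ Complex.two_pi_I_ne_zero
    field_simp at hn
    linear_combination Real.pi * Complex.I * 2 * hn
  have hdvd : (q : ℤ) ∣ ((2 * k : ℕ) : ℤ) := ⟨n, by exact_mod_cast hkn⟩
  have hq2 := Nat.le_of_dvd two_pos
    ((Nat.Coprime.symm hgcd).dvd_of_dvd_mul_right (Int.natCast_dvd_natCast.1 hdvd))
  lia

/-- Any two consecutive circular shifts of one period of the CCPS are linearly
independent over `ℂ` and span the complex conjugate subspace `v_{q,k}`; in
particular they form a basis of `v_{q,k}`. -/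
theorem consecutive_ccps_shifts_basis (q k : ℕ) (hq : 3 ≤ q)
    (hk1 : 1 ≤ k) (hk2 : k ≤ q / 2) (hgcd : Nat.gcd k q = 1) (l : ℤ) :
    let a : Fin q → ℂ := fun n =>
      ((2 * Real.cos (2 * Real.pi * (k : ℝ) * (((n : ℕ) : ℝ) - (l : ℝ)) / (q : ℝ)) : ℝ) : ℂ)
    let b : Fin q → ℂ := fun n =>
      ((2 * Real.cos (2 * Real.pi * (k : ℝ) * (((n : ℕ) : ℝ) - (l : ℝ) - 1) / (q : ℝ)) : ℝ) : ℂ)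
    LinearIndependent ℂ ![a, b] ∧
      Submodule.span ℂ {a, b} =
        Submodule.span ℂ
          {(fun n : Fin q =>
              Complex.exp (2 * (Real.pi : ℂ) * Complex.I * (k : ℂ) * ((n : ℕ) : ℂ) / (q : ℂ))),
           (fun n : Fin q =>
              Complex.exp (-(2 * (Real.pi : ℂ) * Complex.I * (k : ℂ) * ((n : ℕ) : ℂ)) / (q : ℂ)))} := by
  intro a b
  set u : Fin q → ℂ := fun n =>
    Complex.exp (2 * (Real.pi : ℂ) * Complex.I * (k : ℂ) * ((n : ℕ) : ℂ) / (q : ℂ)) with hu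
  set v : Fin q → ℂ := fun n =>
    Complex.exp (-(2 * (Real.pi : ℂ) * Complex.I * (k : ℂ) * ((n : ℕ) : ℂ)) / (q : ℂ)) with hv
  have hne := exp_two_pi_mul_I_div_ne_exp_neg hq hgcd
  set c : ℂ → ℂ := fun m => Complex.exp (2 * Real.pi * Complex.I * k * m / q) with hc
  have ha : a = c (-l) • u + c l • v := by
    funext n
    simp only [a, hu, hv, hc, Pi.add_apply, Pi.smul_apply, smul_eq_mul, ← Complex.exp_add]
    push_cast
    rw [Complex.two_cos]
    congr 2 <;> ring
  have hb : b = c (-l - 1) • u + c (l + 1) • v := by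
    funext n
    simp only [b, hu, hv, hc, Pi.add_apply, Pi.smul_apply, smul_eq_mul, ← Complex.exp_add]
    push_cast
    rw [Complex.two_cos]
    congr 2 <;> ring
  have hdet : c (-l) * c (l + 1) - c l * c (-l - 1) ≠ 0 := by
    simp only [hc, ← Complex.exp_add]
    convert sub_ne_zero.2 hne using 3 <;> ring
  have huv : LinearIndependent ℂ ![u, v] := by
    rw [LinearIndependent.pair_iff]
    intro s t hst
    have h0 := congrFun hst ⟨0, by lia⟩
    have h1 := congrFun hst ⟨1, by lia⟩
    simp only [hu, hv, Pi.add_apply, Pi.smul_apply, smul_eq_mul, Pi.zero_apply, Nat.cast_zero,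
      Nat.cast_one, mul_zero, mul_one, neg_zero, zero_div, Complex.exp_zero] at h0 h1
    have hs : s = 0 := by
      apply (mul_eq_zero.1 _).resolve_right (sub_ne_zero.2 hne)
      linear_combination
        h1 - Complex.exp (-(2 * Real.pi * Complex.I * k) / q) * h0
    exact ⟨hs, by simpa [hs] using h0⟩
  rw [ha, hb]
  exact ⟨LinearIndependent.pair_add_smul_add_smul_iff _ _ _ _ |>.2 ⟨huv, sub_ne_zero.1 hdet⟩, span_pair_smul_add_smul u v hdet⟩
end

section
/- Let N be a positive integer, q ≥ 3 a divisor of N, and k an integer with 1 ≤ k ≤ ⌊q/2⌋ and gcd(k,q) = 1. Then the N×N matrix P_{q,k} whose (i,j) entry is (1/N)·2cos(2πk(i−j)/q) satisfies P_{q,k}² = P_{q,k} and P_{q,k}^H = P_{q,k}, and its range is the ℂ-span in ℂ^N of the two N-periodic exponential vectors (e^{2πikn/q})_{n=0}^{N−1} and (e^{−2πikn/q})_{n=0}^{N−1}; i.e. P_{q,k} is the orthogonal projection of ℂ^N onto the N-periodic extension of the complex conjugate subspace v_{q,k}, and it has an N/q × N/q block-circulant structure with identical blocks (q/N)·\hat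 P_{q,k} where \hat P_{q,k} = (1/q)D_{q,k}. -/
open Matrix

/-- The matrix `c⁻¹ (u wᵀ + w uᵀ)` is idempotent when `u`, `w` are isotropic
with `u ⬝ w = c ≠ 0`. -/
theorem hyperbolic_pair_isIdempotent {ι K : Type*} [Fintype ι] [Field K] {u w : ι → K} {c : K}
    (hc : c ≠ 0) (huw : u ⬝ᵥ w = c) (huu : u ⬝ᵥ u = 0) (hww : w ⬝ᵥ w = 0) :
    (c⁻¹ • (vecMulVec u w + vecMulVec w u)) * (c⁻¹ • (vecMulVec u w + vecMulVec w u)) =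
      c⁻¹ • (vecMulVec u w + vecMulVec w u) := by
  have hwu : w ⬝ᵥ u = c := by rw [dotProduct_comm, huw]
  simp only [smul_mul_smul_comm, add_mul, mul_add, vecMulVec_mul_vecMulVec, huw, huu, hww, hwu]
  ext i j
  simp only [Matrix.smul_apply, Matrix.add_apply, vecMulVec_apply, Pi.smul_apply, smul_eq_mul]
  field_simp
  ring

/-- The range of `c⁻¹ (u wᵀ + w uᵀ)` is the span of `u` and `w` when `u`, `w` are isotropic
with `u ⬝ w = c ≠ 0`. -/
theorem range_hyperbolic_pair {ι K : Type*} [Fintype ι] [Field K] {u w : ι → K} {c : K}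
    (hc : c ≠ 0) (huw : u ⬝ᵥ w = c) (huu : u ⬝ᵥ u = 0) (hww : w ⬝ᵥ w = 0) :
    LinearMap.range (c⁻¹ • (vecMulVec u w + vecMulVec w u)).mulVecLin =
      Submodule.span K {u, w} := by
  have hwu : w ⬝ᵥ u = c := by rw [dotProduct_comm, huw]
  have key (x : ι → K) : (c⁻¹ • (vecMulVec u w + vecMulVec w u)) *ᵥ x =
      (c⁻¹ * (w ⬝ᵥ x)) • u + (c⁻¹ * (u ⬝ᵥ x)) • w := by
    ext i
    simp only [smul_mulVec, add_mulVec, vecMulVec_mulVec, Pi.smul_apply, Pi.add_apply,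
      MulOpposite.smul_eq_mul_unop, MulOpposite.unop_op, smul_eq_mul]
    ring
  apply le_antisymm
  · rintro _ ⟨x, rfl⟩
    rw [mulVecLin_apply, key]
    exact Submodule.mem_span_pair.2 ⟨_, _, rfl⟩
  · rw [Submodule.span_le]
    rintro _ (rfl | rfl)
    · exact ⟨_, by rw [mulVecLin_apply, key, huu, hwu]; simp [hc]⟩
    · exact ⟨_, by rw [mulVecLin_apply, key, hww, huw]; simp [hc]⟩

/-- The powers of an `N`-th root of unity whose square is not `1` form an isotropic vector. -/
theorem dotProduct_pow_self_eq_zero {K : Type*} [Field K] {N : ℕ} {z : K} (hz : z ^ N = 1)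
    (hz2 : z ^ 2 ≠ 1) :
    (fun n : Fin N => z ^ (n : ℕ)) ⬝ᵥ (fun n : Fin N => z ^ (n : ℕ)) = 0 := by
  simp only [dotProduct, ← mul_pow]
  rw [Fin.sum_univ_eq_sum_range (fun n => (z * z) ^ n), ← pow_two, geom_sum_eq hz2, ← pow_mul, mul_comm,
    pow_mul, hz]
  simp

/-- The powers of `z` and of `z⁻¹` pair to the number of terms. -/
theorem dotProduct_pow_inv_pow {K : Type*} [Field K] {N : ℕ} {z : K} (hz : z ≠ 0) :
    (fun n : Fin N => z ^ (n : ℕ)) ⬝ᵥ (fun n : Fin N => z⁻¹ ^ (n : ℕ)) = N := by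
  simp [dotProduct, hz]

/-- Reducing the two indices modulo `q` does not change `cos (2πk(i - j)/q)`. -/
theorem cos_two_pi_mul_sub_div_mod {q : ℕ} (hq : q ≠ 0) (k i j : ℕ) :
    Real.cos (2 * Real.pi * (k : ℝ) * ((i : ℝ) - (j : ℝ)) / (q : ℝ)) =
      Real.cos (2 * Real.pi * (k : ℝ) * (((i % q : ℕ) : ℝ) - ((j % q : ℕ) : ℝ)) / (q : ℝ)) := by
  have hq' : (q : ℝ) ≠ 0 := by exact_mod_cast hq
  have hi : (i : ℝ) = (i % q : ℕ) + q * (i / q : ℕ) := by exact_mod_cast (Nat.mod_add_div i q).symm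
  have hj : (j : ℝ) = (j % q : ℕ) + q * (j / q : ℕ) := by exact_mod_cast (Nat.mod_add_div j q).symm
  rw [← Real.cos_add_int_mul_two_pi _ ((k : ℤ) * ((j / q : ℕ) - (i / q : ℕ) : ℤ))]
  congr 1
  conv_lhs => rw [hi, hj]
  simp only [Int.cast_mul, Int.cast_sub, Int.cast_natCast]
  field_simp
  ring

/-- For `q ∣ N`, the `N×N` matrix `P_{q,k}` with `(i,j)` entry
`(1/N)·2cos(2πk(i−j)/q)` is the orthogonal projection of `ℂ^N` onto the
`N`-periodic extension of the CCS `v_{q,k}`: it is idempotent and Hermitian,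
its range is the span of the two `N`-periodic exponential vectors
`e^{±2πikn/q}`, and it is block-circulant with identical `q×q` blocks
`(q/N)·P̂_{q,k}` where `P̂_{q,k} = (1/q)·D_{q,k}`. -/
theorem block_circulant_projection_onto_periodic_ccs (N q k : ℕ) (hN : 0 < N) (hq : 3 ≤ q)
    (hdvd : q ∣ N) (hk1 : 1 ≤ k) (hk2 : k ≤ q / 2) (hgcd : Nat.gcd k q = 1) :
    let P : Matrix (Fin N) (Fin N) ℂ := fun i j =>
      (((1 / (N : ℝ)) * (2 * Real.cos (2 * Real.pi * (k : ℝ) * (((i : ℕ) : ℝ) - ((j : ℕ) : ℝ)) / (q : ℝ))) : ℝ) : ℂ)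
    P * P = P ∧ Pᴴ = P ∧
      LinearMap.range P.mulVecLin =
        Submodule.span ℂ
          {(fun n : Fin N =>
              Complex.exp (2 * (Real.pi : ℂ) * Complex.I * (k : ℂ) * ((n : ℕ) : ℂ) / (q : ℂ))),
           (fun n : Fin N =>
              Complex.exp (-(2 * (Real.pi : ℂ) * Complex.I * (k : ℂ) * ((n : ℕ) : ℂ)) / (q : ℂ)))} ∧
      ∀ i j : Fin N, P i j =
        (((q : ℝ) / (N : ℝ)) *
          ((1 / (q : ℝ)) *
            (2 * Real.cos (2 * Real.pi * (k : ℝ) *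
              ((((i : ℕ) % q : ℕ) : ℝ) - (((j : ℕ) % q : ℕ) : ℝ)) / (q : ℝ)))) : ℝ) := by
  intro P
  have hq0 : q ≠ 0 := by omega
  have hNC : (N : ℂ) ≠ 0 := by exact_mod_cast hN.ne'
  set z : ℂ := Complex.exp (2 * Real.pi * Complex.I * (k / q)) with hz
  have hprim : IsPrimitiveRoot z q := Complex.isPrimitiveRoot_exp_of_coprime k q hq0 hgcd
  have hz0 : z ≠ 0 := Complex.exp_ne_zero _
  have hzN : z ^ N = 1 := (hprim.pow_eq_one_iff_dvd N).2 hdvd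
  have hz2 : z ^ 2 ≠ 1 := fun h => by
    have := Nat.le_of_dvd two_pos (hprim.dvd_of_pow_eq_one 2 h)
    omega
  have hu (n : ℕ) : Complex.exp (2 * (Real.pi : ℂ) * Complex.I * (k : ℂ) * (n : ℂ) / (q : ℂ)) =
      z ^ n := by
    rw [hz, ← Complex.exp_nat_mul]
    congr 1
    ring
  have hw (n : ℕ) : Complex.exp (-(2 * (Real.pi : ℂ) * Complex.I * (k : ℂ) * (n : ℂ)) / (q : ℂ)) =
      z⁻¹ ^ n := by
    rw [neg_div, Complex.exp_neg, hu, inv_pow]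
  set u : Fin N → ℂ := fun n => z ^ (n : ℕ) with hudef
  set w : Fin N → ℂ := fun n => z⁻¹ ^ (n : ℕ) with hwdef
  have hP : P = (N : ℂ)⁻¹ • (vecMulVec u w + vecMulVec w u) := by
    ext i j
    simp only [P, hudef, hwdef, Matrix.smul_apply, Matrix.add_apply, vecMulVec_apply, smul_eq_mul]
    simp only [← hu, ← hw, ← Complex.exp_add]
    push_cast
    rw [Complex.two_cos, one_div]
    congr 3 <;> ring
  have huw : u ⬝ᵥ w = N := dotProduct_pow_inv_pow hz0
  have huu : u ⬝ᵥ u = 0 := dotProduct_pow_self_eq_zero hzN hz2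
  have hww : w ⬝ᵥ w = 0 :=
    dotProduct_pow_self_eq_zero (by rw [inv_pow, hzN, inv_one])
      (by rwa [inv_pow, ne_eq, inv_eq_one])
  refine ⟨?_, ?_, ?_, fun i j => ?_⟩
  · rw [hP]
    exact hyperbolic_pair_isIdempotent hNC huw huu hww
  · ext i j
    rw [conjTranspose_apply]
    simp only [P, Complex.star_def, Complex.conj_ofReal]
    rw [← Real.cos_neg]
    congr 4
    ring
  · simp only [hu, hw]
    rw [hP]
    exact range_hyperbolic_pair hNC huw huu hww
  · simp only [P]
    rw [cos_two_pi_mul_sub_div_mod hq0]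
    congr 1
    have : (q : ℝ) ≠ 0 := by exact_mod_cast hq0
    field_simp
end

section
/- (Orthogonality of CCPSs.) Let q₁, q₂ be positive integers, k₁ ∈ Û_{q₁}, k₂ ∈ Û_{q₂} (with k = 1 when q = 1), let N = lcm(q₁,q₂), and let l₁, l₂ be integers. Then ∑_{n=0}^{N−1} c_{q₁,k₁}(n−l₁)·c_{q₂,k₂}(n−l₂) = 2NM·cos(2πk₁(l₁−l₂)/q₁) if q₁ = q₂ and k₁ = k₂ (where M = 1/2 if q₁ ≤ 2 and M = 1 if q₁ ≥ 3), and the sum equals 0 otherwise. -/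
open Finset in
/-- A sinusoid with non-integral frequency `x` sums to zero over `N` consecutive integers
whenever `N * x` is an integer. -/
theorem sum_range_cos_eq_zero {N : ℕ} {x : ℝ} {m : ℤ} (hm : (N : ℝ) * x = m)
    (hx : ∀ t : ℤ, x ≠ t) (φ : ℝ) :
    ∑ n ∈ range N, Real.cos (2 * Real.pi * x * n + φ) = 0 := by
  have hsin : Real.sin (Real.pi * x) ≠ 0 := by
    intro h
    obtain ⟨t, ht⟩ := Real.sin_eq_zero_iff.mp h
    exact hx t (mul_left_cancel₀ Real.pi_ne_zero (by linarith))
  have htel : ∀ n : ℕ, 2 * Real.sin (Real.pi * x) * Real.cos (2 * Real.pi * x * n + φ) =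
      Real.sin (2 * Real.pi * x * (n + 1 : ℕ) + φ - Real.pi * x) -
        Real.sin (2 * Real.pi * x * n + φ - Real.pi * x) := by
    intro n
    have e : 2 * Real.pi * x * (n + 1 : ℕ) + φ - Real.pi * x =
        (2 * Real.pi * x * n + φ) + Real.pi * x := by push_cast; ring
    rw [e, Real.sin_add, Real.sin_sub]
    ring
  have hsum : 2 * Real.sin (Real.pi * x) *
      ∑ n ∈ range N, Real.cos (2 * Real.pi * x * n + φ) = 0 := by
    rw [mul_sum, sum_congr rfl fun n _ => htel n,
      sum_range_sub fun n : ℕ => Real.sin (2 * Real.pi * x * n + φ - Real.pi * x)]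
    have e : 2 * Real.pi * x * N + φ - Real.pi * x =
        2 * Real.pi * x * (0 : ℕ) + φ - Real.pi * x + m * (2 * Real.pi) := by
      rw [← hm]; push_cast; ring
    rw [e, Real.sin_add_int_mul_two_pi, sub_self]
  simpa [hsin] using hsum

open Finset in
theorem sum_range_cos_of_int (N : ℕ) {x : ℝ} {t : ℤ} (hx : x = t) (φ : ℝ) :
    ∑ n ∈ range N, Real.cos (2 * Real.pi * x * n + φ) = N * Real.cos φ := by
  have h : ∀ n : ℕ, Real.cos (2 * Real.pi * x * n + φ) = Real.cos φ := by
    intro n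
    have e : 2 * Real.pi * x * n + φ = φ + ((t * n : ℤ) : ℝ) * (2 * Real.pi) := by
      rw [hx]; push_cast; ring
    rw [e, Real.cos_add_int_mul_two_pi]
  simp [h]

/-- Fractions in lowest terms whose sum or difference is an integer have equal denominators. -/
theorem Nat.Coprime.eq_of_mul_add_mul_eq {q₁ q₂ k₁ k₂ : ℕ} (h₁ : k₁.Coprime q₁)
    (h₂ : k₂.Coprime q₂) {e t : ℤ} (he : IsUnit e)
    (h : (k₁ * q₂ + e * (k₂ * q₁) : ℤ) = t * (q₁ * q₂)) : q₁ = q₂ := by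
  apply Nat.dvd_antisymm
  · refine h₁.symm.dvd_of_dvd_mul_left (Int.natCast_dvd_natCast.mp ⟨t * q₂ - e * k₂, ?_⟩)
    push_cast
    linear_combination h
  · refine h₂.symm.dvd_of_dvd_mul_left (Int.natCast_dvd_natCast.mp ?_)
    have : (q₂ : ℤ) ∣ e * (k₂ * q₁) := ⟨t * q₁ - k₁, by linear_combination h⟩
    push_cast
    exact he.dvd_mul_left.mp this


/-- Orthogonality of CCPSs: with `N = lcm(q₁,q₂)` and `M(q) = 1/2` for
`q ≤ 2`, `M(q) = 1` for `q ≥ 3`,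
`∑_{n=0}^{N−1} c_{q₁,k₁}(n−l₁)·c_{q₂,k₂}(n−l₂)` equals
`2·N·M(q₁)·cos(2πk₁(l₁−l₂)/q₁)` when `(q₁,k₁) = (q₂,k₂)` and `0` otherwise. -/
theorem ccps_orthogonality (q₁ q₂ k₁ k₂ : ℕ) (hq₁ : 0 < q₁) (hq₂ : 0 < q₂)
    (hk₁ : (q₁ = 1 ∧ k₁ = 1) ∨ (2 ≤ q₁ ∧ 1 ≤ k₁ ∧ k₁ ≤ q₁ / 2 ∧ Nat.gcd k₁ q₁ = 1))
    (hk₂ : (q₂ = 1 ∧ k₂ = 1) ∨ (2 ≤ q₂ ∧ 1 ≤ k₂ ∧ k₂ ≤ q₂ / 2 ∧ Nat.gcd k₂ q₂ = 1))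
    (l₁ l₂ : ℤ) :
    let M : ℕ → ℝ := fun q => if q ≤ 2 then 1 / 2 else 1
    let c : ℕ → ℕ → ℤ → ℝ := fun q k n =>
      2 * M q * Real.cos (2 * Real.pi * (k : ℝ) * (n : ℝ) / (q : ℝ))
    ∑ n ∈ Finset.range (Nat.lcm q₁ q₂), c q₁ k₁ ((n : ℤ) - l₁) * c q₂ k₂ ((n : ℤ) - l₂) =
      if q₁ = q₂ ∧ k₁ = k₂ then
        2 * (Nat.lcm q₁ q₂ : ℝ) * M q₁ * Real.cos (2 * Real.pi * (k₁ : ℝ) * ((l₁ : ℝ) - (l₂ : ℝ)) / (q₁ : ℝ))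
      else 0 := by
  intro M c
  have hc₁ : k₁.Coprime q₁ := by
    rcases hk₁ with ⟨rfl, rfl⟩ | h
    · exact Nat.coprime_one_right 1
    · exact h.2.2.2
  have hc₂ : k₂.Coprime q₂ := by
    rcases hk₂ with ⟨rfl, rfl⟩ | h
    · exact Nat.coprime_one_right 1
    · exact h.2.2.2
  have hr₁ : (q₁ : ℝ) ≠ 0 := by positivity
  have hr₂ : (q₂ : ℝ) ≠ 0 := by positivity
  set N := Nat.lcm q₁ q₂ with hN
  obtain ⟨a₁, ha₁⟩ : q₁ ∣ N := Nat.dvd_lcm_left q₁ q₂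
  obtain ⟨a₂, ha₂⟩ : q₂ ∣ N := Nat.dvd_lcm_right q₁ q₂
  have hx₁ : (N : ℝ) * (k₁ / q₁) = (a₁ * k₁ : ℕ) := by
    rw [ha₁]; push_cast; field_simp
  have hx₂ : (N : ℝ) * (k₂ / q₂) = (a₂ * k₂ : ℕ) := by
    rw [ha₂]; push_cast; field_simp
  set φ₁ : ℝ := 2 * Real.pi * (k₁ / q₁) * l₁ with hφ₁
  set φ₂ : ℝ := 2 * Real.pi * (k₂ / q₂) * l₂ with hφ₂
  have hdiff : ∀ t : ℤ, (k₁ / q₁ - k₂ / q₂ : ℝ) = t → q₁ = q₂ ∧ k₁ = k₂ := by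
    intro t ht
    field_simp at ht
    have hz : (k₁ * q₂ + (-1) * (k₂ * q₁) : ℤ) = t * (q₁ * q₂) := by
      have : (k₁ * q₂ + (-1) * (k₂ * q₁) : ℝ) = t * (q₁ * q₂) := by linear_combination ht
      exact_mod_cast this
    obtain rfl := hc₁.eq_of_mul_add_mul_eq hc₂ isUnit_neg_one hz
    refine ⟨rfl, ?_⟩
    have hd : (q₁ : ℤ) ∣ k₁ - k₂ :=
      ⟨t, mul_right_cancel₀ (by positivity : (q₁ : ℤ) ≠ 0) (by linear_combination hz)⟩
    have := Int.eq_zero_of_abs_lt_dvd hd (by rw [abs_lt]; omega)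
    omega
  have hsum : ∀ t : ℤ, (k₁ / q₁ + k₂ / q₂ : ℝ) = t → (q₁ = q₂ ∧ k₁ = k₂) ∧ q₁ ≤ 2 := by
    intro t ht
    field_simp at ht
    have hz : (k₁ * q₂ + 1 * (k₂ * q₁) : ℤ) = t * (q₁ * q₂) := by
      have : (k₁ * q₂ + 1 * (k₂ * q₁) : ℝ) = t * (q₁ * q₂) := by linear_combination ht
      exact_mod_cast this
    obtain rfl := hc₁.eq_of_mul_add_mul_eq hc₂ isUnit_one hz
    have hd : (q₁ : ℤ) ∣ (k₁ + k₂ : ℕ) :=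
      ⟨t, mul_right_cancel₀ (by positivity : (q₁ : ℤ) ≠ 0) (by push_cast; linear_combination hz)⟩
    have hle := Nat.le_of_dvd (by omega) (Int.natCast_dvd_natCast.mp hd)
    rcases hk₁ with ⟨h, rfl⟩ | h
    · omega
    · have hk : k₁ = k₂ := by omega
      have hdvd : k₁ ∣ q₁ := ⟨2, by omega⟩
      have := hc₁.eq_one_of_dvd hdvd
      omega
  have hterm : ∀ n : ℕ, c q₁ k₁ ((n : ℤ) - l₁) * c q₂ k₂ ((n : ℤ) - l₂) =
      2 * M q₁ * M q₂ *
        (Real.cos (2 * Real.pi * (k₁ / q₁ - k₂ / q₂) * n + (φ₂ - φ₁)) +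
          Real.cos (2 * Real.pi * (k₁ / q₁ + k₂ / q₂) * n + -(φ₁ + φ₂))) := by
    intro n
    have e₁ : 2 * Real.pi * (k₁ : ℝ) * (((n : ℤ) - l₁ : ℤ) : ℝ) / q₁ =
        2 * Real.pi * (k₁ / q₁) * n - φ₁ := by
      rw [hφ₁]; push_cast; ring
    have e₂ : 2 * Real.pi * (k₂ : ℝ) * (((n : ℤ) - l₂ : ℤ) : ℝ) / q₂ =
        2 * Real.pi * (k₂ / q₂) * n - φ₂ := by
      rw [hφ₂]; push_cast; ring
    have e₃ : 2 * Real.pi * (k₁ / q₁ - k₂ / q₂) * n + (φ₂ - φ₁) =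
        (2 * Real.pi * (k₁ / q₁) * n - φ₁) - (2 * Real.pi * (k₂ / q₂) * n - φ₂) := by ring
    have e₄ : 2 * Real.pi * (k₁ / q₁ + k₂ / q₂) * n + -(φ₁ + φ₂) =
        (2 * Real.pi * (k₁ / q₁) * n - φ₁) + (2 * Real.pi * (k₂ / q₂) * n - φ₂) := by ring
    simp only [c]
    rw [e₁, e₂, e₃, e₄, Real.cos_sub (_ - φ₁), Real.cos_add (_ - φ₁)]
    ring
  rw [Finset.sum_congr rfl fun n _ => hterm n, ← Finset.mul_sum, Finset.sum_add_distrib]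
  have hNd : (N : ℝ) * (k₁ / q₁ - k₂ / q₂) = ((a₁ * k₁ : ℕ) - (a₂ * k₂ : ℕ) : ℤ) := by
    rw [mul_sub, hx₁, hx₂]; push_cast; ring
  have hNs : (N : ℝ) * (k₁ / q₁ + k₂ / q₂) = ((a₁ * k₁ : ℕ) + (a₂ * k₂ : ℕ) : ℤ) := by
    rw [mul_add, hx₁, hx₂]; push_cast; ring
  split_ifs with heq
  · obtain ⟨rfl, rfl⟩ := heq
    have hphase : Real.cos (2 * Real.pi * (k₁ : ℝ) * ((l₁ : ℝ) - l₂) / q₁) =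
        Real.cos (φ₂ - φ₁) := by
      rw [← Real.cos_neg]
      congr 1
      rw [hφ₁, hφ₂]; ring
    rw [hphase, sum_range_cos_of_int N (t := 0) (by simp)]
    by_cases hq : q₁ ≤ 2
    · obtain ⟨s, hs⟩ : ∃ s : ℤ, (k₁ / q₁ + k₁ / q₁ : ℝ) = s := by
        have : q₁ = 1 ∨ q₁ = 2 := by omega
        rcases this with rfl | rfl
        · exact ⟨k₁ + k₁, by push_cast; ring⟩
        · exact ⟨k₁, by push_cast; ring⟩
      have hshift : -(φ₁ + φ₂) = φ₂ - φ₁ - ((s * l₂ : ℤ) : ℝ) * (2 * Real.pi) := by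
        push_cast
        rw [← hs, hφ₁, hφ₂]; ring
      rw [sum_range_cos_of_int N hs, hshift, Real.cos_sub_int_mul_two_pi]
      simp only [M, if_pos hq]
      ring
    · rw [sum_range_cos_eq_zero hNs fun t ht => hq (hsum t ht).2]
      simp only [M, if_neg hq]
      ring
  · rw [sum_range_cos_eq_zero hNd fun t ht => heq (hdiff t ht),
      sum_range_cos_eq_zero hNs fun t ht => heq (hsum t ht).1]
    ring
end

section
/- Let q₁, q₂ be positive integers, k₁ ∈ Û_{q₁}, k₂ ∈ Û_{q₂} (with k = 1 when q = 1), with (q₁,k₁) ≠ (q₂,k₂), and let N = lcm(q₁,q₂). Then the N-periodic extensions of the complex conjugate subspaces v_{q₁,k₁} and v_{q₂,k₂} are orthogonal in ℂ^N: for every x in the ℂ-span of (e^{±2πik₁n/q₁})_{n=0}^{N−1} and every y in the ℂ-span of (e^{±2πik₂n/q₂})_{n=0}^{N−1}, ⟨x, y⟩ = 0. -/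
/-- Two exponential sequences whose frequencies differ modulo one are orthogonal over any common
period. -/
theorem sum_conj_exp_mul_exp_eq_zero {q r N : ℕ} {a b : ℤ} (hq : 0 < q) (hr : 0 < r)
    (hqN : q ∣ N) (hrN : r ∣ N) (h : ¬ (q * r : ℤ) ∣ b * q - a * r) :
    ∑ n : Fin N, starRingEnd ℂ
        (Complex.exp (2 * (Real.pi : ℂ) * Complex.I * (a : ℂ) * ((n : ℕ) : ℂ) / (q : ℂ))) *
      Complex.exp (2 * (Real.pi : ℂ) * Complex.I * (b : ℂ) * ((n : ℕ) : ℂ) / (r : ℂ)) = 0 := by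
  have hq0 : (q : ℂ) ≠ 0 := by exact_mod_cast hq.ne'
  have hr0 : (r : ℂ) ≠ 0 := by exact_mod_cast hr.ne'
  have hpi : (2 * (Real.pi : ℂ) * Complex.I) ≠ 0 := Complex.two_pi_I_ne_zero
  set z : ℂ := Complex.exp (2 * (Real.pi : ℂ) * Complex.I * ((b : ℂ) / r - (a : ℂ) / q)) with hz
  have hterm (n : ℕ) : starRingEnd ℂ
        (Complex.exp (2 * (Real.pi : ℂ) * Complex.I * (a : ℂ) * (n : ℂ) / (q : ℂ))) *
      Complex.exp (2 * (Real.pi : ℂ) * Complex.I * (b : ℂ) * (n : ℂ) / (r : ℂ)) = z ^ n := by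
    rw [hz, ← Complex.exp_conj, ← Complex.exp_add, ← Complex.exp_nat_mul]
    congr 1
    simp only [map_mul, map_div₀, Complex.conj_I, Complex.conj_ofReal, map_natCast, map_intCast,
      map_ofNat]
    ring
  have hz1 : z ≠ 1 := by
    intro hz'
    obtain ⟨m, hm⟩ := Complex.exp_eq_one_iff.mp hz'
    rw [mul_comm (m : ℂ)] at hm
    have hm' := mul_left_cancel₀ hpi hm
    field_simp at hm'
    refine h ⟨m, ?_⟩
    have : ((b * q - a * r : ℤ) : ℂ) = ((q * r * m : ℤ) : ℂ) := by
      push_cast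
      linear_combination hm'
    exact_mod_cast this
  have hzN : z ^ N = 1 := by
    obtain ⟨c, hc⟩ := hqN
    obtain ⟨d, hd⟩ := hrN
    have hc' : (N : ℂ) = q * c := by exact_mod_cast hc
    have hd' : (N : ℂ) = r * d := by exact_mod_cast hd
    rw [hz, ← Complex.exp_nat_mul, Complex.exp_eq_one_iff]
    refine ⟨b * d - a * c, ?_⟩
    have hb : (N : ℂ) * (b / r) = b * d := by rw [hd']; field_simp
    have ha : (N : ℂ) * (a / q) = a * c := by rw [hc']; field_simp
    push_cast
    linear_combination (2 * (Real.pi : ℂ) * Complex.I) * (hb - ha)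
  simp_rw [hterm]
  rw [Fin.sum_univ_eq_sum_range (fun n => z ^ n) N, geom_sum_eq hz1, hzN, sub_self, zero_div]

/-- Distinct reduced fractions with denominators `q`, `r` in `(0, 1/2] ∪ {1}` are not congruent
modulo one, even up to sign. -/
theorem not_mul_dvd_sub_of_reduced {q r k l : ℕ} {a b : ℤ} (hq : 0 < q) (hr : 0 < r)
    (hk : (q = 1 ∧ k = 1) ∨ (2 ≤ q ∧ 1 ≤ k ∧ k ≤ q / 2 ∧ Nat.gcd k q = 1))
    (hl : (r = 1 ∧ l = 1) ∨ (2 ≤ r ∧ 1 ≤ l ∧ l ≤ r / 2 ∧ Nat.gcd l r = 1))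
    (hne : ¬(q = r ∧ k = l)) (ha : a = k ∨ a = -k) (hb : b = l ∨ b = -l) :
    ¬ (q * r : ℤ) ∣ b * q - a * r := by
  intro h
  have hkq : Nat.Coprime q k := by
    rcases hk with ⟨rfl, rfl⟩ | h
    · simp
    · exact Nat.Coprime.symm h.2.2.2
  have hlr : Nat.Coprime r l := by
    rcases hl with ⟨rfl, rfl⟩ | h
    · simp
    · exact Nat.Coprime.symm h.2.2.2
  have hqa : IsCoprime (q : ℤ) a := by
    have := Nat.isCoprime_iff_coprime.mpr hkq
    rcases ha with rfl | rfl
    exacts [this, this.neg_right]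
  have hrb : IsCoprime (r : ℤ) b := by
    have := Nat.isCoprime_iff_coprime.mpr hlr
    rcases hb with rfl | rfl
    exacts [this, this.neg_right]
  have hqr : q ∣ r := by
    have h1 : (q : ℤ) ∣ a * r :=
      (dvd_sub_right (Dvd.intro_left b rfl)).mp ((Dvd.intro _ rfl).trans h)
    exact_mod_cast hqa.dvd_of_dvd_mul_left h1
  have hrq : r ∣ q := by
    have h1 : (r : ℤ) ∣ b * q :=
      (dvd_sub_left (Dvd.intro_left a rfl)).mp ((Dvd.intro_left _ rfl).trans h)
    exact_mod_cast hrb.dvd_of_dvd_mul_left h1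
  obtain rfl := Nat.dvd_antisymm hqr hrq
  rw [← sub_mul] at h
  obtain ⟨m, hm⟩ := Int.dvd_of_mul_dvd_mul_right (by exact_mod_cast hq.ne') h
  rcases hk with hk | hk <;> rcases hl with hl | hl
  · omega
  · omega
  · omega
  · have hm1 : m = -1 ∨ m = 0 ∨ m = 1 := by
      have h1 : m < 2 := by
        by_contra! hc
        have := mul_le_mul_of_nonneg_left hc (Int.natCast_nonneg q)
        omega
      have h2 : -2 < m := by
        by_contra! hc
        have := mul_le_mul_of_nonneg_left hc (Int.natCast_nonneg q)
        omega
      omega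
    rcases hm1 with rfl | rfl | rfl <;> omega

/-- For `(q₁,k₁) ≠ (q₂,k₂)` (with `kᵢ ∈ Û_{qᵢ}`, `k = 1` when `q = 1`) and
`N = lcm(q₁,q₂)`, the `N`-periodic extensions of the complex conjugate
subspaces `v_{q₁,k₁}` and `v_{q₂,k₂}` are orthogonal in `ℂ^N`. -/
theorem ccs_subspaces_orthogonal (q₁ q₂ k₁ k₂ : ℕ) (hq₁ : 0 < q₁) (hq₂ : 0 < q₂)
    (hk₁ : (q₁ = 1 ∧ k₁ = 1) ∨ (2 ≤ q₁ ∧ 1 ≤ k₁ ∧ k₁ ≤ q₁ / 2 ∧ Nat.gcd k₁ q₁ = 1))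
    (hk₂ : (q₂ = 1 ∧ k₂ = 1) ∨ (2 ≤ q₂ ∧ 1 ≤ k₂ ∧ k₂ ≤ q₂ / 2 ∧ Nat.gcd k₂ q₂ = 1))
    (hne : ¬(q₁ = q₂ ∧ k₁ = k₂)) :
    ∀ x ∈ Submodule.span ℂ
        {(fun n : Fin (Nat.lcm q₁ q₂) =>
            Complex.exp (2 * (Real.pi : ℂ) * Complex.I * (k₁ : ℂ) * ((n : ℕ) : ℂ) / (q₁ : ℂ))),
         (fun n : Fin (Nat.lcm q₁ q₂) =>
            Complex.exp (-(2 * (Real.pi : ℂ) * Complex.I * (k₁ : ℂ) * ((n : ℕ) : ℂ)) / (q₁ : ℂ)))},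
    ∀ y ∈ Submodule.span ℂ
        {(fun n : Fin (Nat.lcm q₁ q₂) =>
            Complex.exp (2 * (Real.pi : ℂ) * Complex.I * (k₂ : ℂ) * ((n : ℕ) : ℂ) / (q₂ : ℂ))),
         (fun n : Fin (Nat.lcm q₁ q₂) =>
            Complex.exp (-(2 * (Real.pi : ℂ) * Complex.I * (k₂ : ℂ) * ((n : ℕ) : ℂ)) / (q₂ : ℂ)))},
    ∑ n : Fin (Nat.lcm q₁ q₂), starRingEnd ℂ (x n) * y n = 0 := by
  intro x hx y hy
  obtain ⟨c₁, d₁, rfl⟩ := Submodule.mem_span_pair.mp hx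
  obtain ⟨c₂, d₂, rfl⟩ := Submodule.mem_span_pair.mp hy
  have orth (a b : ℤ) (ha : a = k₁ ∨ a = -k₁) (hb : b = k₂ ∨ b = -k₂) :=
    sum_conj_exp_mul_exp_eq_zero hq₁ hq₂ (Nat.dvd_lcm_left q₁ q₂) (Nat.dvd_lcm_right q₁ q₂)
      (not_mul_dvd_sub_of_reduced hq₁ hq₂ hk₁ hk₂ hne ha hb)
  have hpp := orth k₁ k₂ (.inl rfl) (.inl rfl)
  have hpm := orth k₁ (-k₂) (.inl rfl) (.inr rfl)
  have hmp := orth (-k₁) k₂ (.inr rfl) (.inl rfl)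
  have hmm := orth (-k₁) (-k₂) (.inr rfl) (.inr rfl)
  simp only [Int.cast_neg, Int.cast_natCast, mul_neg, neg_mul] at hpp hpm hmp hmm
  simp only [Pi.add_apply, Pi.smul_apply, smul_eq_mul, map_add, map_mul (starRingEnd ℂ)]
  have key := congrArg₂ (· + ·)
    (congrArg₂ (· + ·) (congrArg (starRingEnd ℂ c₁ * c₂ * ·) hpp)
      (congrArg (starRingEnd ℂ c₁ * d₂ * ·) hpm))
    (congrArg₂ (· + ·) (congrArg (starRingEnd ℂ d₁ * c₂ * ·) hmp)
      (congrArg (starRingEnd ℂ d₁ * d₂ * ·) hmm))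
  simp only [mul_zero, add_zero, Finset.mul_sum, ← Finset.sum_add_distrib] at key
  rw [← key]
  exact Finset.sum_congr rfl fun n _ => by ring
end

section
/- Let q ≥ 3 be an integer and k an integer with 1 ≤ k ≤ ⌊q/2⌋ and gcd(k,q) = 1. Then the circular autocorrelation of one period of the CCPS equals q times the CCPS: for every integer l, ∑_{n=0}^{q−1} 2cos(2πkn/q)·2cos(2πk(n−l)/q) = q·2cos(2πkl/q). -/
/-- Equally spaced cosines covering `m` full turns in `q` steps sum to zero unless `q ∣ m`. -/
theorem sum_range_cos_eq_zero_of_not_dvd {q m : ℕ} (hm : ¬ q ∣ m) (b : ℝ) :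
    ∑ n ∈ Finset.range q, Real.cos (2 * Real.pi * m / q * n + b) = 0 := by
  rcases eq_or_ne q 0 with rfl | hq
  · simp
  have hq' : (q : ℝ) ≠ 0 := Nat.cast_ne_zero.mpr hq
  have hπ := Real.pi_ne_zero
  rw [Real.sum_cos q (fun j hj => hm ?_)]
  · have : (q : ℝ) * (2 * Real.pi * m / q) / 2 = m * Real.pi := by field_simp
    simp [this, Real.sin_nat_mul_pi]
  · field_simp at hj
    have hj' : (m : ℤ) = q * j := by exact_mod_cast hj
    exact Int.natCast_dvd_natCast.mp ⟨j, hj'⟩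

/-- The circular autocorrelation of one period of the CCPS equals `q` times
the CCPS: for every integer `l`,
`∑_{n=0}^{q−1} 2cos(2πkn/q)·2cos(2πk(n−l)/q) = q·2cos(2πkl/q)`. -/
theorem ccps_autocorrelation (q k : ℕ) (hq : 3 ≤ q)
    (hk1 : 1 ≤ k) (hk2 : k ≤ q / 2) (hgcd : Nat.gcd k q = 1) (l : ℤ) :
    ∑ n ∈ Finset.range q,
        (2 * Real.cos (2 * Real.pi * (k : ℝ) * (n : ℝ) / (q : ℝ))) *
          (2 * Real.cos (2 * Real.pi * (k : ℝ) * ((n : ℝ) - (l : ℝ)) / (q : ℝ))) =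
      (q : ℝ) * (2 * Real.cos (2 * Real.pi * (k : ℝ) * (l : ℝ) / (q : ℝ))) := by
  have hdvd : ¬ q ∣ 2 * k := fun h => by
    have := Nat.le_of_dvd two_pos ((Nat.Coprime.symm hgcd).dvd_of_dvd_mul_right h)
    omega
  have hsum := sum_range_cos_eq_zero_of_not_dvd hdvd (-(2 * Real.pi * k * l / q))
  have hterm : ∀ n : ℕ,
      (2 * Real.cos (2 * Real.pi * k * n / q)) * (2 * Real.cos (2 * Real.pi * k * (n - l) / q)) =
        2 * Real.cos (2 * Real.pi * k * l / q) +
          2 * Real.cos (2 * Real.pi * (2 * k : ℕ) / q * n + -(2 * Real.pi * k * l / q)) := by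
    intro n
    have h := Real.two_mul_cos_mul_cos (2 * Real.pi * k * n / q) (2 * Real.pi * k * (n - l) / q)
    have h₁ : 2 * Real.pi * k * n / q - 2 * Real.pi * k * (n - l) / q =
        2 * Real.pi * k * l / q := by ring
    have h₂ : 2 * Real.pi * k * n / q + 2 * Real.pi * k * (n - l) / q =
        2 * Real.pi * (2 * k : ℕ) / q * n + -(2 * Real.pi * k * l / q) := by
      push_cast
      ring
    rw [h₁, h₂] at h
    linear_combination 2 * h
  simp only [hterm, Finset.sum_add_distrib, ← Finset.mul_sum, hsum, Finset.sum_const,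
    Finset.card_range, nsmul_eq_mul]
  ring
end

section
/- (CCS is closed under circular cross-correlation.) Let q ≥ 3 be an integer and k an integer with 1 ≤ k ≤ ⌊q/2⌋ and gcd(k,q) = 1. If x ∈ v_{q,k} and y ∈ v_{q,k} (subspace of ℂ^q), then the circular cross-correlation vector r_{xy}, defined by r_{xy}(l) = ∑_{n=0}^{q−1} x(n)·conj(y((n−l) mod q)) for 0 ≤ l ≤ q−1, also belongs to v_{q,k}. -/
/-- The correlation of any `x` with a vector spanned by two characters `e`, `f` is again in
their span. -/
theorem crossCorrelation_mem_span_pair {q : ℕ} {e f : Fin q → ℂ}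
    (he : ∀ n l, starRingEnd ℂ (e (n - l)) = starRingEnd ℂ (e n) * e l)
    (hf : ∀ n l, starRingEnd ℂ (f (n - l)) = starRingEnd ℂ (f n) * f l)
    (x : Fin q → ℂ) {y : Fin q → ℂ} (hy : y ∈ Submodule.span ℂ {e, f}) :
    (fun l => ∑ n, x n * starRingEnd ℂ (y (n - l))) ∈ Submodule.span ℂ {e, f} := by
  obtain ⟨a, b, rfl⟩ := Submodule.mem_span_pair.1 hy
  refine Submodule.mem_span_pair.2
    ⟨∑ n, x n * starRingEnd ℂ (a * e n), ∑ n, x n * starRingEnd ℂ (b * f n), ?_⟩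
  funext l
  simp only [Pi.add_apply, Pi.smul_apply, smul_eq_mul, Finset.sum_mul, ← Finset.sum_add_distrib,
    map_add, map_mul, he, hf]
  exact Finset.sum_congr rfl fun n _ => by ring

theorem conj_exp_fin_sub {q : ℕ} (a : ℤ) (n l : Fin q) :
    starRingEnd ℂ (Complex.exp (2 * Real.pi * Complex.I * a * ((n - l : Fin q) : ℕ) / q)) =
      starRingEnd ℂ (Complex.exp (2 * Real.pi * Complex.I * a * (n : ℕ) / q)) *
        Complex.exp (2 * Real.pi * Complex.I * a * (l : ℕ) / q) := by
  have hq : (q : ℂ) ≠ 0 := Nat.cast_ne_zero.2 (Nat.ne_zero_of_lt n.isLt)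
  obtain ⟨m, hm⟩ : ∃ m : ℤ, (((n - l : Fin q) : ℕ) : ℤ) = n - l + m * q := by
    rcases le_or_gt l n with h | h
    · exact ⟨0, by rw [Fin.sub_val_of_le h, Nat.cast_sub h]; ring⟩
    · refine ⟨1, ?_⟩
      rw [Fin.coe_sub_iff_lt.2 h]
      have := l.isLt
      omega
  have hm' : (((n - l : Fin q) : ℕ) : ℂ) = (n : ℕ) - (l : ℕ) + m * q := by exact_mod_cast hm
  rw [← Complex.exp_conj, ← Complex.exp_conj, ← Complex.exp_add, hm',
    Complex.exp_eq_exp_iff_exists_int]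
  refine ⟨-(a * m), ?_⟩
  simp only [map_div₀, map_mul, map_add, map_sub, map_ofNat, map_natCast, map_intCast,
    Complex.conj_I, Complex.conj_ofReal]
  push_cast
  field_simp
  ring

/-- CCS is closed under circular cross-correlation: if `x, y ∈ v_{q,k} ⊆ ℂ^q`,
then the vector `r_{xy}(l) = ∑_{n=0}^{q−1} x(n)·conj(y((n−l) mod q))` also
belongs to `v_{q,k}`.  (Subtraction in `Fin q` is subtraction mod `q`.) -/
theorem ccs_closed_under_cross_correlation (q k : ℕ) (hq : 3 ≤ q)
    (hk1 : 1 ≤ k) (hk2 : k ≤ q / 2) (hgcd : Nat.gcd k q = 1)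
    (x y : Fin q → ℂ)
    (hx : x ∈ Submodule.span ℂ
      {(fun n : Fin q =>
          Complex.exp (2 * (Real.pi : ℂ) * Complex.I * (k : ℂ) * ((n : ℕ) : ℂ) / (q : ℂ))),
       (fun n : Fin q =>
          Complex.exp (-(2 * (Real.pi : ℂ) * Complex.I * (k : ℂ) * ((n : ℕ) : ℂ)) / (q : ℂ)))})
    (hy : y ∈ Submodule.span ℂ
      {(fun n : Fin q =>
          Complex.exp (2 * (Real.pi : ℂ) * Complex.I * (k : ℂ) * ((n : ℕ) : ℂ) / (q : ℂ))),
       (fun n : Fin q =>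
          Complex.exp (-(2 * (Real.pi : ℂ) * Complex.I * (k : ℂ) * ((n : ℕ) : ℂ)) / (q : ℂ)))}) :
    (fun l : Fin q => ∑ n : Fin q, x n * starRingEnd ℂ (y (n - l))) ∈
      Submodule.span ℂ
        {(fun n : Fin q =>
            Complex.exp (2 * (Real.pi : ℂ) * Complex.I * (k : ℂ) * ((n : ℕ) : ℂ) / (q : ℂ))),
         (fun n : Fin q =>
            Complex.exp (-(2 * (Real.pi : ℂ) * Complex.I * (k : ℂ) * ((n : ℕ) : ℂ)) / (q : ℂ)))} := by
  refine crossCorrelation_mem_span_pair (fun n l => ?_) (fun n l => ?_) x hy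
  · simpa using conj_exp_fin_sub (k : ℤ) n l
  · simpa only [Int.cast_neg, Int.cast_natCast, mul_neg, neg_mul] using
      conj_exp_fin_sub (-(k : ℤ)) n l
end

section
/- Let N be a positive integer, and for x ∈ ℂ^N let x_{q,k} denote the orthogonal projection of x onto the N-periodic extension of the complex conjugate subspace v_{q,k}, for each divisor q of N and each k ∈ Û_q (with k = 1 for q = 1). Let (q₁,k₁) ≠ (q₂,k₂) be two such index pairs. Then for every integer l, the circular cross-correlation of the two projections vanishes: ∑_{n=0}^{N−1} x_{q₁,k₁}(n)·conj(x_{q₂,k₂}((n−l) mod N)) = 0. -/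
/-- `Û_q`: the reduced residues up to `⌊q/2⌋`, with `Û_1 = {1}`. -/
def Uhat (q : ℕ) : Finset ℕ :=
  if q = 1 then {1} else (Finset.Icc 1 (q / 2)).filter fun k => Nat.gcd k q = 1

/-- The `N`-periodic extension of the complex conjugate subspace `v_{q,k}`,
i.e. the span in `ℂ^N` of `(e^{2πikn/q})_{n<N}` and `(e^{−2πikn/q})_{n<N}`. -/
noncomputable def ccsExt (N q k : ℕ) : Submodule ℂ (Fin N → ℂ) :=
  Submodule.span ℂ
    {(fun n : Fin N =>
        Complex.exp (2 * (Real.pi : ℂ) * Complex.I * (k : ℂ) * ((n : ℕ) : ℂ) / (q : ℂ))),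
     (fun n : Fin N =>
        Complex.exp (-(2 * (Real.pi : ℂ) * Complex.I * (k : ℂ) * ((n : ℕ) : ℂ)) / (q : ℂ)))}

/-- Circular shift of an index: `n ↦ (n − l) mod N`. -/
def shiftIdx {N : ℕ} (l : ℤ) (n : Fin N) : Fin N :=
  ⟨((((n : ℕ) : ℤ) - l) % (N : ℤ)).toNat, by
    have hN : 0 < N := n.pos
    have h1 : 0 ≤ (((n : ℕ) : ℤ) - l) % (N : ℤ) := Int.emod_nonneg _ (by omega)
    have h2 : (((n : ℕ) : ℤ) - l) % (N : ℤ) < (N : ℤ) :=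
      Int.emod_lt_of_pos _ (by exact_mod_cast hN)
    omega⟩

/-- The character `j ↦ e^{2πicj/N}` of `ℤ` with period `N`. -/
noncomputable def expChar (N : ℕ) (c j : ℤ) : ℂ :=
  Complex.exp (2 * (Real.pi : ℂ) * Complex.I * (c : ℂ) * (j : ℂ) / (N : ℂ))

lemma expChar_add_right (N : ℕ) (c i j : ℤ) :
    expChar N c (i + j) = expChar N c i * expChar N c j := by
  rw [expChar, expChar, expChar, ← Complex.exp_add]
  push_cast
  ring_nf

lemma expChar_sub_left (N : ℕ) (a b j : ℤ) :
    expChar N (a - b) j = expChar N a j * starRingEnd ℂ (expChar N b j) := by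
  rw [expChar, expChar, expChar, ← Complex.exp_conj, ← Complex.exp_add]
  simp only [map_div₀, map_mul, Complex.conj_ofReal, Complex.conj_I, map_ofNat, map_intCast,
    map_natCast]
  push_cast
  ring_nf

lemma expChar_period_mul {N : ℕ} (hN : 0 < N) (c t : ℤ) : expChar N c (N * t) = 1 := by
  have hN' : (N : ℂ) ≠ 0 := by exact_mod_cast hN.ne'
  rw [expChar, Complex.exp_eq_one_iff]
  refine ⟨c * t, ?_⟩
  push_cast
  field_simp

lemma expChar_natCast (N : ℕ) (c : ℤ) (n : ℕ) : expChar N c n = expChar N c 1 ^ n := by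
  rw [expChar, expChar, ← Complex.exp_nat_mul]
  push_cast
  ring_nf

lemma expChar_one_ne_one {N : ℕ} (hN : 0 < N) {c : ℤ} (hc : ¬ (N : ℤ) ∣ c) :
    expChar N c 1 ≠ 1 := by
  have hN' : (N : ℂ) ≠ 0 := by exact_mod_cast hN.ne'
  rw [expChar, Ne, Complex.exp_eq_one_iff]
  rintro ⟨t, ht⟩
  refine hc ⟨t, ?_⟩
  have h2 : (2 * (Real.pi : ℂ) * Complex.I) ≠ 0 := Complex.two_pi_I_ne_zero
  have h : (2 * (Real.pi : ℂ) * Complex.I) * (c : ℂ) =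
      (2 * (Real.pi : ℂ) * Complex.I) * ((N : ℂ) * t) := by
    rw [div_eq_iff hN'] at ht
    push_cast at ht
    linear_combination ht
  exact_mod_cast mul_left_cancel₀ h2 h

lemma sum_expChar_eq_zero {N : ℕ} (hN : 0 < N) {c : ℤ} (hc : ¬ (N : ℤ) ∣ c) :
    ∑ n : Fin N, expChar N c (n : ℕ) = 0 := by
  have hper : expChar N c 1 ^ N = 1 := by
    rw [← expChar_natCast]
    simpa using expChar_period_mul hN c 1
  simp_rw [expChar_natCast]
  rw [Fin.sum_univ_eq_sum_range (fun n => expChar N c 1 ^ n) N,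
    geom_sum_eq (expChar_one_ne_one hN hc), hper, sub_self, zero_div]

lemma expChar_shiftIdx {N : ℕ} (c l : ℤ) (n : Fin N) :
    expChar N c (shiftIdx l n : ℕ) = expChar N c (n : ℕ) * expChar N c (-l) := by
  have hval : ((shiftIdx l n : ℕ) : ℤ) = (((n : ℕ) : ℤ) - l) % N :=
    Int.toNat_of_nonneg (Int.emod_nonneg _ (by have := n.pos; omega))
  rw [hval, ← expChar_add_right, ← sub_eq_add_neg]
  conv_rhs => rw [← Int.emod_add_mul_ediv ((n : ℕ) - l : ℤ) N]
  rw [expChar_add_right, expChar_period_mul n.pos, mul_one]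

lemma sum_expChar_mul_conj_shiftIdx {N : ℕ} (hN : 0 < N) {a b : ℤ} (h : ¬ (N : ℤ) ∣ a - b)
    (l : ℤ) :
    ∑ n : Fin N, expChar N a (n : ℕ) * starRingEnd ℂ (expChar N b (shiftIdx l n : ℕ)) = 0 := by
  simp_rw [expChar_shiftIdx, map_mul, ← mul_assoc, ← expChar_sub_left]
  rw [← Finset.sum_mul, sum_expChar_eq_zero hN h, zero_mul]

lemma exists_eq_expChar_of_mem_ccsExt {N q m k : ℕ} (hN : 0 < N) (hm : N = q * m)
    {x : Fin N → ℂ} (hx : x ∈ ccsExt N q k) :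
    ∃ a b : ℂ, ∀ n : Fin N,
      x n = a * expChar N (k * m) (n : ℕ) + b * expChar N (-(k * m)) (n : ℕ) := by
  obtain ⟨a, b, rfl⟩ := Submodule.mem_span_pair.mp hx
  refine ⟨a, b, fun n => ?_⟩
  have hqm : 0 < q * m := hm ▸ hN
  have hq : (q : ℂ) ≠ 0 := by exact_mod_cast (Nat.pos_of_mul_pos_right hqm).ne'
  have hm' : (m : ℂ) ≠ 0 := by exact_mod_cast (Nat.pos_of_mul_pos_left hqm).ne'
  have hNc : (N : ℂ) = q * m := by exact_mod_cast hm
  simp only [Pi.add_apply, Pi.smul_apply, smul_eq_mul, expChar]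
  rw [hNc]
  push_cast
  congr 3 <;> field_simp

lemma coprime_of_mem_Uhat {q k : ℕ} (hk : k ∈ Uhat q) : Nat.gcd k q = 1 := by
  unfold Uhat at hk
  split_ifs at hk with h
  · simp [h]
  · exact (Finset.mem_filter.mp hk).2

lemma gcd_mul_eq_of_mem_Uhat {N q m k : ℕ} (hm : N = q * m) (hk : k ∈ Uhat q) {a : ℤ}
    (ha : a = k * m ∨ a = -(k * m)) : Int.gcd a N = m := by
  have h : Nat.gcd (k * m) (q * m) = m := by
    rw [Nat.gcd_mul_right, coprime_of_mem_Uhat hk, one_mul]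
  have h' : Int.gcd ((k : ℤ) * m) N = m := by
    rw [hm]
    exact_mod_cast h
  rcases ha with rfl | rfl
  · exact h'
  · rwa [Int.neg_gcd]

/-- Up to sign, the frequencies attached to distinct index pairs differ modulo `N`. -/
lemma eq_of_dvd_sub_of_mem_Uhat {N q₁ q₂ m₁ m₂ k₁ k₂ : ℕ} (hN : 0 < N)
    (hm₁ : N = q₁ * m₁) (hm₂ : N = q₂ * m₂) (hk₁ : k₁ ∈ Uhat q₁) (hk₂ : k₂ ∈ Uhat q₂)
    {a b : ℤ} (ha : a = k₁ * m₁ ∨ a = -(k₁ * m₁)) (hb : b = k₂ * m₂ ∨ b = -(k₂ * m₂))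
    (h : (N : ℤ) ∣ a - b) : q₁ = q₂ ∧ k₁ = k₂ := by
  have hmm : m₁ = m₂ := by
    rw [← gcd_mul_eq_of_mem_Uhat hm₁ hk₁ ha, ← gcd_mul_eq_of_mem_Uhat hm₂ hk₂ hb]
    obtain ⟨t, ht⟩ := h
    rw [show a = b + N * t by linarith, mul_comm (N : ℤ) t, Int.gcd_add_mul_right_left]
  subst hmm
  have hm : 0 < m₁ := Nat.pos_of_mul_pos_left (hm₁ ▸ hN)
  have hqq : q₁ = q₂ := Nat.eq_of_mul_eq_mul_right hm (hm₁.symm.trans hm₂)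
  subst hqq
  refine ⟨rfl, ?_⟩
  have hm' : (m₁ : ℤ) ≠ 0 := by exact_mod_cast hm.ne'
  have key : ∀ c : ℤ, a - b = c * m₁ → (q₁ : ℤ) ∣ c := fun c hc => by
    rw [hc, hm₁] at h
    push_cast at h
    exact (mul_dvd_mul_iff_right hm').mp h
  unfold Uhat at hk₁ hk₂
  split_ifs at hk₁ hk₂ with h1
  · rw [Finset.mem_singleton.mp hk₁, Finset.mem_singleton.mp hk₂]
  simp only [Finset.mem_filter, Finset.mem_Icc] at hk₁ hk₂
  have hdiff : (q₁ : ℤ) ∣ k₁ - k₂ → k₁ = k₂ := fun hd => by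
    have := Int.eq_zero_of_abs_lt_dvd hd (by rw [abs_lt]; omega)
    omega
  have hsum : (q₁ : ℤ) ∣ k₁ + k₂ → k₁ = k₂ := fun hd => by
    have := Int.le_of_dvd (by omega) hd
    omega
  rcases ha with rfl | rfl <;> rcases hb with rfl | rfl
  · exact hdiff (key _ (by ring))
  · exact hsum (key _ (by ring))
  · exact hsum ((dvd_neg).mp (key _ (by ring)))
  · exact hdiff ((dvd_neg).mp (key _ (by ring)))

/-- The circular cross-correlation of the orthogonal projections of `x ∈ ℂ^N`
onto the `N`-periodic extensions of two distinct complex conjugate subspaces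
`v_{q₁,k₁}` and `v_{q₂,k₂}` (here `x₁, x₂`, characterized as the unique
elements of the subspaces with `x − xᵢ` orthogonal to the subspace) vanishes
identically. -/
theorem cross_correlation_of_distinct_projections_eq_zero
    (N q₁ q₂ k₁ k₂ : ℕ) (hN : 0 < N) (hq₁ : q₁ ∣ N) (hq₂ : q₂ ∣ N)
    (hk₁ : k₁ ∈ Uhat q₁) (hk₂ : k₂ ∈ Uhat q₂)
    (hne : ¬(q₁ = q₂ ∧ k₁ = k₂))
    (x x₁ x₂ : Fin N → ℂ)
    (hx₁ : x₁ ∈ ccsExt N q₁ k₁)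
    (hx₁perp : ∀ v ∈ ccsExt N q₁ k₁, ∑ n : Fin N, starRingEnd ℂ (v n) * (x n - x₁ n) = 0)
    (hx₂ : x₂ ∈ ccsExt N q₂ k₂)
    (hx₂perp : ∀ v ∈ ccsExt N q₂ k₂, ∑ n : Fin N, starRingEnd ℂ (v n) * (x n - x₂ n) = 0)
    (l : ℤ) :
    ∑ n : Fin N, x₁ n * starRingEnd ℂ (x₂ (shiftIdx l n)) = 0 := by
  obtain ⟨m₁, hm₁⟩ := hq₁
  obtain ⟨m₂, hm₂⟩ := hq₂
  obtain ⟨a, b, hab⟩ := exists_eq_expChar_of_mem_ccsExt hN hm₁ hx₁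
  obtain ⟨c, d, hcd⟩ := exists_eq_expChar_of_mem_ccsExt hN hm₂ hx₂
  have orth : ∀ s t : ℤ, (s = k₁ * m₁ ∨ s = -(k₁ * m₁)) → (t = k₂ * m₂ ∨ t = -(k₂ * m₂)) →
      ∑ n : Fin N, expChar N s (n : ℕ) * starRingEnd ℂ (expChar N t (shiftIdx l n : ℕ)) = 0 :=
    fun s t hs ht => sum_expChar_mul_conj_shiftIdx hN
      (fun hd => hne (eq_of_dvd_sub_of_mem_Uhat hN hm₁ hm₂ hk₁ hk₂ hs ht hd)) l
  have h₁ := orth _ _ (.inl rfl) (.inl rfl)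
  have h₂ := orth _ _ (.inl rfl) (.inr rfl)
  have h₃ := orth _ _ (.inr rfl) (.inl rfl)
  have h₄ := orth _ _ (.inr rfl) (.inr rfl)
  have expand : ∀ A B C D : ℂ,
      (a * A + b * B) * starRingEnd ℂ (c * C + d * D) =
        a * starRingEnd ℂ c * (A * starRingEnd ℂ C) + a * starRingEnd ℂ d * (A * starRingEnd ℂ D) +
        b * starRingEnd ℂ c * (B * starRingEnd ℂ C) + b * starRingEnd ℂ d * (B * starRingEnd ℂ D) :=
    fun A B C D => by
      simp only [map_add, map_mul]
      ring
  simp_rw [hab, hcd, expand, Finset.sum_add_distrib, ← Finset.mul_sum, h₁, h₂, h₃, h₄]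
  simp
end
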